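/- Let 𝒮 = {μ_1, …, μ_m} be a finite set of pmfs on a countable set 𝒳, let h_1, …, h_M be real-valued functions on joint pmfs on 𝒳×𝒴 with constraint levels θ ∈ ℝ^M, and assume feasibility of the robust information rate function R̄(θ). Then every rate R > R̄(θ) is asymptotically achievable: for every ε > 0 there exists N_0 such that for all N ≥ N_0 there exist a random variable Z, an encoder f_N : 𝒳^N × 𝒵 → ℕ and a decoder g_N : ℕ × 𝒵 → 𝒴^N such that, for every μ ∈ 𝒮, taking X^N = (X_1,…,X_N) i.i.d. with law μ and independent of Z, M = f_N(X^N, Z) and Y^N = g_N(M, Z), one has H(M|Z)/N ≤ R̄(θ) + ε and h_i(P_{X_j, Y_j}) ≤ θ_i for every i ∈ {1,…,M} and every coordinate j ∈ {1,…,N}. -/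

import Mathlib

open MeasureTheory ProbabilityTheory
open scoped ENNReal

/-- Base-2 entropy of a pmf on a countable type: `H(p) = -∑ p(a) log₂ p(a)`. -/
noncomputable def ent2 {𝒴 : Type*} (p : PMF 𝒴) : ℝ :=
  ∑' y, -((p y).toReal * Real.logb 2 (p y).toReal)

/-- Joint pmf `μ(x) Q(y|x)` on `𝒳 × 𝒴` induced by a source pmf `μ` and a Markov kernel `Q`. -/
noncomputable def jointPMF {𝒳 𝒴 : Type*} (μ : PMF 𝒳) (Q : 𝒳 → PMF 𝒴) : PMF (𝒳 × 𝒴) :=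
  μ.bind fun x => (Q x).map (Prod.mk x)

/-- Summand of the mutual information `I(μ, Q)` (base 2). -/
noncomputable def miSummand {𝒳 𝒴 : Type*} (μ : PMF 𝒳) (Q : 𝒳 → PMF 𝒴) (p : 𝒳 × 𝒴) : ℝ :=
  ((μ p.1) * (Q p.1 p.2)).toReal *
    Real.logb 2 ((Q p.1 p.2).toReal / ((μ.bind Q) p.2).toReal)

/-- Mutual information (base 2) `I(μ, Q) = ∑_{x,y} μ(x)Q(y|x) log₂ (Q(y|x)/q(y))`. -/
noncomputable def mutInfo {𝒳 𝒴 : Type*} (μ : PMF 𝒳) (Q : 𝒳 → PMF 𝒴) : ℝ :=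
  ∑' p, miSummand μ Q p

/-- `κ` is a regular conditional distribution of the (discrete-valued) random variable `Y`
given `Z`, under the probability measure `P`. -/
def IsCondDistrib {Ω 𝒴 𝒵 : Type*} [MeasurableSpace Ω] [MeasurableSpace 𝒵]
    (P : Measure Ω) (Y : Ω → 𝒴) (Z : Ω → 𝒵) (κ : 𝒵 → PMF 𝒴) : Prop :=
  (∀ y, Measurable fun z => κ z y) ∧
    ∀ (y : 𝒴) (A : Set 𝒵), MeasurableSet A →
      P {ω | Y ω = y ∧ Z ω ∈ A} = ∫⁻ z in A, κ z y ∂(P.map Z)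

/-- The constraint set `𝓛(θ)` of Markov kernels `Q` with `h_i(μ_α ⊗ Q) ≤ θ_i` for all
sources `μ_α` in the family and all `i`. -/
def constraintSet {𝒳 𝒴 ι : Type*} {M : ℕ} (μS : ι → PMF 𝒳)
    (h : Fin M → PMF (𝒳 × 𝒴) → ℝ) (θ : Fin M → ℝ) : Set (𝒳 → PMF 𝒴) :=
  {Q | ∀ (α : ι) (i : Fin M), h i (jointPMF (μS α) Q) ≤ θ i}

/-- The robust information rate function
`R̄(θ) = inf_{Q ∈ 𝓛(θ)} max_α I(μ_α, Q)` (the infimum being over the kernels in `𝓛(θ)`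
with finite worst-case mutual information, the others having value `+∞`). -/
noncomputable def Rbar {𝒳 𝒴 ι : Type*} {M : ℕ} (μS : ι → PMF 𝒳)
    (h : Fin M → PMF (𝒳 × 𝒴) → ℝ) (θ : Fin M → ℝ) : ℝ :=
  sInf {r | ∃ Q ∈ constraintSet μS h θ,
    (∀ α, Summable (miSummand (μS α) Q)) ∧ r = ⨆ α, mutInfo (μS α) Q}

/-- Feasibility of the robust information rate function: some kernel in `𝓛(θ)` has finite
worst-case mutual information. -/
def RIRFFeasible {𝒳 𝒴 ι : Type*} {M : ℕ} (μS : ι → PMF 𝒳)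
    (h : Fin M → PMF (𝒳 × 𝒴) → ℝ) (θ : Fin M → ℝ) : Prop :=
  ∃ Q ∈ constraintSet μS h θ, ∀ α, Summable (miSummand (μS α) Q)

/-- A rate `R` is robust one-shot achievable: there are a source of common randomness `Z ∼ PZ`,
a measurable encoder `f` and a measurable decoder `g` such that for every source `μ_α` of the
family, taking `X ∼ μ_α` independent of `Z` (the two coordinates of the product space),
`M = f(X, Z)` and `Y = g(M, Z)`, one has `H(M | Z) ≤ R` and `h_i(P_{X,Y}) ≤ θ_i` for all `i`. -/
def RobustOneShotAchievable {𝒳 𝒴 : Type*} [MeasurableSpace 𝒳] [MeasurableSpace 𝒴]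
    {ι : Type*} {M : ℕ} (μS : ι → PMF 𝒳) (h : Fin M → PMF (𝒳 × 𝒴) → ℝ)
    (θ : Fin M → ℝ) (R : ℝ) : Prop :=
  ∃ (𝒵 : Type) (_ : MeasurableSpace 𝒵) (PZ : Measure 𝒵)
    (f : 𝒳 × 𝒵 → ℕ) (g : ℕ × 𝒵 → 𝒴),
    IsProbabilityMeasure PZ ∧ Measurable f ∧ Measurable g ∧
    ∀ α : ι,
      (∃ κ : 𝒵 → PMF ℕ,
        IsCondDistrib ((μS α).toMeasure.prod PZ) (fun ω => f ω) Prod.snd κ ∧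
        ∫ z, ent2 (κ z) ∂PZ ≤ R) ∧
      ∃ p : PMF (𝒳 × 𝒴),
        (((μS α).toMeasure.prod PZ).map fun ω => (ω.1, g (f ω, ω.2))) = p.toMeasure ∧
        ∀ i, h i p ≤ θ i

/-- Index of the first term of the sequence `w` lying in `A` (and `0` if there is none). -/
noncomputable def firstHit {W : Type*} (A : Set W) (w : ℕ → W) : ℕ := sInf {k | w k ∈ A}

lemma firstHit_eq_iff {W : Type*} {A : Set W} {w : ℕ → W} {k : ℕ} :
    firstHit A w = k ↔ ((∀ i < k, w i ∉ A) ∧ w k ∈ A) ∨ (k = 0 ∧ ∀ i, w i ∉ A) := by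
  constructor
  · rintro rfl
    by_cases hne : ({k | w k ∈ A} : Set ℕ).Nonempty
    · exact Or.inl ⟨fun i hi => Nat.notMem_of_lt_sInf hi, Nat.sInf_mem hne⟩
    · rw [Set.not_nonempty_iff_eq_empty] at hne
      refine Or.inr ⟨by simp [firstHit, hne], fun i hi => ?_⟩
      exact (Set.ext_iff.mp hne i).mp hi
  · rintro (⟨h1, h2⟩ | ⟨rfl, h2⟩)
    · refine le_antisymm (Nat.sInf_le h2) ?_
      by_contra! hlt
      exact h1 _ hlt (Nat.sInf_mem (s := {k | w k ∈ A}) ⟨k, h2⟩)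
    · simp [firstHit, h2]

section FirstHit

variable {W : Type*} [MeasurableSpace W]

lemma measurable_firstHit {A : Set W} (hA : MeasurableSet A) : Measurable (firstHit A) := by
  refine measurable_to_countable' fun k => ?_
  have hev (i : ℕ) : MeasurableSet {w : ℕ → W | w i ∈ A} := measurable_pi_apply i hA
  have : firstHit A ⁻¹' {k} = ((⋂ i ∈ Set.Iio k, {w : ℕ → W | w i ∈ A}ᶜ) ∩ {w | w k ∈ A}) ∪
      ({w | k = 0} ∩ ⋂ i, {w : ℕ → W | w i ∈ A}ᶜ) := by
    ext w
    simp [firstHit_eq_iff]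
  rw [this]
  refine (MeasurableSet.inter ?_ (hev k)).union (MeasurableSet.inter (by simp) ?_)
  · exact MeasurableSet.biInter (Set.to_countable _) fun i _ => (hev i).compl
  · exact MeasurableSet.iInter fun i => (hev i).compl

variable (ρ : Measure W) [IsProbabilityMeasure ρ]

lemma infinitePi_first_mem {A B : Set W} (hA : MeasurableSet A) (hB : MeasurableSet B) (k : ℕ) :
    Measure.infinitePi (fun _ : ℕ => ρ) {w | (∀ i < k, w i ∉ A) ∧ w k ∈ B} =
      (1 - ρ A) ^ k * ρ B := by
  have hset : {w : ℕ → W | (∀ i < k, w i ∉ A) ∧ w k ∈ B} =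
      (Finset.range (k + 1) : Set ℕ).pi fun i => if i < k then Aᶜ else B := by
    ext w
    simp only [Set.mem_ofPred_eq, Set.mem_pi, Finset.coe_range, Set.mem_Iio]
    constructor
    · rintro ⟨h1, h2⟩ i hi
      split_ifs with hik
      · exact h1 i hik
      · obtain rfl : i = k := by omega
        exact h2
    · intro h
      refine ⟨fun i hi => ?_, ?_⟩
      · simpa [hi] using h i (by omega)
      · simpa using h k (by omega)
  rw [hset, Measure.infinitePi_pi, Finset.prod_range_succ]
  · have : ∏ i ∈ Finset.range k, ρ (if i < k then Aᶜ else B) = ∏ i ∈ Finset.range k, ρ Aᶜ :=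
      Finset.prod_congr rfl fun i hi => by rw [if_pos (Finset.mem_range.mp hi)]
    simp [this, prob_compl_eq_one_sub hA]
  · intro i _
    split_ifs
    exacts [hA.compl, hB]

lemma tsum_one_sub_pow {s : ℝ≥0∞} (hs : s ≤ 1) : ∑' k : ℕ, (1 - s) ^ k = s⁻¹ := by
  rw [ENNReal.tsum_geometric, ENNReal.sub_sub_cancel ENNReal.one_ne_top hs]

/-- The mean waiting time for a set of probability `s` is at most `1 / s`. -/
lemma lintegral_firstHit_le {A : Set W} (hA : MeasurableSet A) :
    ∫⁻ w, ((firstHit A w : ℝ≥0∞) + 1) ∂Measure.infinitePi (fun _ : ℕ => ρ) ≤ (ρ A)⁻¹ := by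
  have hcount (w : ℕ → W) : ((firstHit A w : ℝ≥0∞) + 1) =
      ∑' k : ℕ, {w | k ≤ firstHit A w}.indicator (fun _ => (1 : ℝ≥0∞)) w := by
    rw [tsum_eq_sum (s := Finset.range (firstHit A w + 1))]
    · rw [Finset.sum_congr rfl (g := fun _ => 1)]
      · simp
      · intro k hk
        rw [Finset.mem_range] at hk
        exact Set.indicator_of_mem (by simp; omega) _
    · intro k hk
      rw [Finset.mem_range] at hk
      exact Set.indicator_of_notMem (by simp; omega) _
  have hmeas (k : ℕ) : MeasurableSet {w | k ≤ firstHit A w} :=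
    measurable_firstHit hA (measurableSet_Ici (a := k))
  simp_rw [hcount]
  rw [lintegral_tsum fun k => (measurable_const.indicator (hmeas k)).aemeasurable,
    ← tsum_one_sub_pow prob_le_one]
  refine ENNReal.tsum_le_tsum fun k => ?_
  rw [lintegral_indicator_const (hmeas k), one_mul]
  calc _ ≤ Measure.infinitePi (fun _ : ℕ => ρ) {w | (∀ i < k, w i ∉ A) ∧ w k ∈ Set.univ} := by
        refine measure_mono fun w hw => ⟨fun i hi => ?_, trivial⟩
        exact Nat.notMem_of_lt_sInf (lt_of_lt_of_le hi hw)
    _ = _ := by rw [infinitePi_first_mem ρ hA .univ]; simp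

/-- The first term lying in `A` has (at least) the conditional law given `A`. -/
lemma div_le_infinitePi_firstHit_mem {A B : Set W} (hA : MeasurableSet A) (hB : MeasurableSet B)
    (hBA : B ⊆ A) :
    ρ B / ρ A ≤ Measure.infinitePi (fun _ : ℕ => ρ) {w | w (firstHit A w) ∈ B} := by
  have hsub : (⋃ k, {w : ℕ → W | (∀ i < k, w i ∉ A) ∧ w k ∈ B}) ⊆ {w | w (firstHit A w) ∈ B} := by
    refine Set.iUnion_subset fun k w hw => ?_
    rw [Set.mem_ofPred_eq, firstHit_eq_iff.mpr (Or.inl ⟨hw.1, hBA hw.2⟩)]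
    exact hw.2
  refine le_trans (le_of_eq ?_) (measure_mono hsub)
  rw [measure_iUnion]
  · simp_rw [infinitePi_first_mem ρ hA hB]
    rw [ENNReal.tsum_mul_right, tsum_one_sub_pow prob_le_one, mul_comm, div_eq_mul_inv]
  · intro i j hij
    refine Set.disjoint_left.mpr fun w hi hj => hij ?_
    rw [← firstHit_eq_iff.mpr (Or.inl ⟨hi.1, hBA hi.2⟩),
      ← firstHit_eq_iff.mpr (Or.inl ⟨hj.1, hBA hj.2⟩)]
  · intro k
    have : {w : ℕ → W | (∀ i < k, w i ∉ A) ∧ w k ∈ B} =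
        (⋂ i ∈ Set.Iio k, {w : ℕ → W | w i ∈ A}ᶜ) ∩ {w | w k ∈ B} := by
      ext w; simp
    rw [this]
    exact (MeasurableSet.biInter (Set.to_countable _)
      fun i _ => (measurable_pi_apply i hA).compl).inter (measurable_pi_apply k hB)

end FirstHit

section Rejection

variable {B : Type*}

/-- The nonnegative integer `⌈log₂ (p y / r y)⌉⁺`. -/
noncomputable def logRatioLevel (p r : PMF B) (y : B) : ℕ :=
  ⌈Real.logb 2 ((p y).toReal / (r y).toReal)⌉₊

lemma le_two_pow_logRatioLevel_mul (p r : PMF B) {y : B} (hy : p y ≠ 0 → r y ≠ 0) :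
    p y ≤ 2 ^ logRatioLevel p r y * r y := by
  by_cases hp : p y = 0
  · simp [hp]
  have hp' : 0 < (p y).toReal := ENNReal.toReal_pos hp (p.apply_ne_top y)
  have hr' : 0 < (r y).toReal := ENNReal.toReal_pos (hy hp) (r.apply_ne_top y)
  have h1 : (p y).toReal / (r y).toReal ≤ 2 ^ (logRatioLevel p r y : ℝ) := by
    rw [← Real.logb_le_iff_le_rpow (by norm_num) (by positivity)]
    exact Nat.le_ceil _
  rw [Real.rpow_natCast, div_le_iff₀ hr'] at h1
  rw [← ENNReal.toReal_le_toReal (p.apply_ne_top y)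
    (ENNReal.mul_ne_top (by finiteness) (r.apply_ne_top y))]
  simpa [ENNReal.toReal_mul] using h1

open Classical in
/-- Probability of accepting a proposal `y ∼ r` when targeting `p` restricted to a level. -/
noncomputable def acceptProb (p r : PMF B) (l : ℕ) (y : B) : ℝ≥0∞ :=
  if logRatioLevel p r y = l then p y / (2 ^ l * r y) else 0

lemma acceptProb_le_one (p r : PMF B) (hpr : ∀ y, p y ≠ 0 → r y ≠ 0) (l : ℕ) (y : B) :
    acceptProb p r l y ≤ 1 := by
  unfold acceptProb
  split_ifs with hl
  · subst hl
    exact ENNReal.div_le_of_le_mul (by simpa using le_two_pow_logRatioLevel_mul p r (hpr y))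
  · exact zero_le

open Classical in
lemma mul_acceptProb (p r : PMF B) (hpr : ∀ y, p y ≠ 0 → r y ≠ 0) (l : ℕ) (y : B) :
    r y * acceptProb p r l y = (if l = logRatioLevel p r y then p y else 0) / 2 ^ l := by
  unfold acceptProb
  by_cases hl : logRatioLevel p r y = l
  · rw [if_pos hl, if_pos hl.symm]
    by_cases hp : p y = 0
    · simp [hp]
    have hr := hpr y hp
    rw [div_eq_mul_inv, ENNReal.mul_inv (Or.inr (r.apply_ne_top y)) (Or.inr hr), div_eq_mul_inv,
      mul_comm, mul_assoc, mul_assoc, ENNReal.inv_mul_cancel hr (r.apply_ne_top y), mul_one]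
  · rw [if_neg hl, if_neg (Ne.symm hl)]
    simp

lemma PMF.eq_of_forall_le_of_tsum_le {p : PMF B} {m : B → ℝ≥0∞} (hle : ∀ y, p y ≤ m y)
    (hm : ∑' y, m y ≤ 1) (y : B) : m y = p y := by
  refine le_antisymm ?_ (hle y)
  by_contra! hlt
  have := ENNReal.tsum_lt_tsum p.tsum_coe_ne_top hle hlt
  rw [p.tsum_coe] at this
  exact absurd hm (not_le.mpr this)

/-- Accepted pairs (proposal, uniform variable). -/
def acceptSet (p r : PMF B) (l : ℕ) : Set (B × unitInterval) :=
  {w | ENNReal.ofReal w.2 < acceptProb p r l w.1}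

lemma unitInterval_volume_ofReal_lt {a : ℝ≥0∞} (ha : a ≤ 1) :
    volume {u : unitInterval | ENNReal.ofReal u < a} = a := by
  have hat : a ≠ ⊤ := ne_top_of_le_ne_top ENNReal.one_ne_top ha
  have ha1 : a.toReal ≤ 1 := by simpa using ENNReal.toReal_mono ENNReal.one_ne_top ha
  have : {u : unitInterval | ENNReal.ofReal u < a} =
      Set.Iio (⟨a.toReal, ENNReal.toReal_nonneg, ha1⟩ : unitInterval) := by
    ext u
    rw [Set.mem_ofPred_eq, Set.mem_Iio, ← Subtype.coe_lt_coe,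
      ENNReal.ofReal_lt_iff_lt_toReal u.2.1 hat]
  rw [this, unitInterval.volume_Iio, ENNReal.ofReal_toReal hat]

variable [MeasurableSpace B] [DiscreteMeasurableSpace B]

lemma measurableSet_acceptSet (p r : PMF B) (l : ℕ) : MeasurableSet (acceptSet p r l) :=
  measurableSet_lt (by fun_prop) ((Measurable.of_discrete (f := acceptProb p r l)).comp
    measurable_fst)

variable [Countable B]

lemma prod_acceptSet_inter (p r : PMF B) (hpr : ∀ y, p y ≠ 0 → r y ≠ 0) (l : ℕ) (y : B) :
    (r.toMeasure.prod (volume : Measure unitInterval)) (acceptSet p r l ∩ {w | w.1 = y}) =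
      r y * acceptProb p r l y := by
  have : acceptSet p r l ∩ {w | w.1 = y} =
      {y} ×ˢ {u : unitInterval | ENNReal.ofReal u < acceptProb p r l y} := by
    ext ⟨a, u⟩
    simp only [acceptSet, Set.mem_inter_iff, Set.mem_ofPred_eq, Set.mem_prod,
      Set.mem_singleton_iff]
    constructor
    · rintro ⟨h, rfl⟩; exact ⟨rfl, h⟩
    · rintro ⟨rfl, h⟩; exact ⟨h, rfl⟩
  rw [this, Measure.prod_prod, PMF.toMeasure_apply_singleton _ _ (.singleton y),
    unitInterval_volume_ofReal_lt (acceptProb_le_one p r hpr l y)]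

lemma prod_acceptSet (p r : PMF B) (hpr : ∀ y, p y ≠ 0 → r y ≠ 0) (l : ℕ) :
    (r.toMeasure.prod (volume : Measure unitInterval)) (acceptSet p r l) =
      p.map (logRatioLevel p r) l / 2 ^ l := by
  have : acceptSet p r l = ⋃ y, acceptSet p r l ∩ {w | w.1 = y} := by
    ext w; simp
  rw [this, measure_iUnion]
  · simp_rw [prod_acceptSet_inter p r hpr, mul_acceptProb p r hpr, PMF.map_apply,
      div_eq_mul_inv, ENNReal.tsum_mul_right]
    congr!
  · intro i j hij
    exact Set.disjoint_left.mpr fun w hi hj => hij (hi.2.symm.trans hj.2)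
  · exact fun y => (measurableSet_acceptSet p r l).inter (measurable_fst (.singleton y))

lemma logb_two_le_add (a : ℝ) {k : ℝ} (hk : 0 < k) :
    Real.logb 2 k ≤ a + 2 * 2 ^ (-a) * k := by
  have h2 : (0 : ℝ) < 2 ^ (-a) := by positivity
  have h : Real.logb 2 (2 ^ (-a) * k) = -a + Real.logb 2 k := by
    rw [Real.logb_mul h2.ne' hk.ne', Real.logb_rpow (by norm_num) (by norm_num)]
  have h3 : Real.logb 2 (2 ^ (-a) * k) ≤ 2 * (2 ^ (-a) * k) := by
    rw [Real.logb, div_le_iff₀ (Real.log_pos (by norm_num))]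
    have := Real.log_le_sub_one_of_pos (mul_pos h2 hk)
    have := Real.log_two_gt_d9
    nlinarith [mul_pos h2 hk]
  linarith

/-- Constant in the cost of describing the index chosen by rejection sampling. -/
noncomputable def rejectionConst (δ : ℝ) : ℝ := 2 * (1 - 2 ^ (-δ))⁻¹

lemma rejectionConst_nonneg {δ : ℝ} (hδ : 0 < δ) : 0 ≤ rejectionConst δ := by
  have h : (2 : ℝ) ^ (-δ) < 1 := Real.rpow_lt_one_of_one_lt_of_neg (by norm_num) (by linarith)
  exact mul_nonneg zero_le_two (inv_nonneg.mpr (by linarith))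

lemma tsum_rejectionConst {δ : ℝ} (hδ : 0 < δ) :
    ∑' l : ℕ, ENNReal.ofReal (2 * 2 ^ (-δ * l)) = ENNReal.ofReal (rejectionConst δ) := by
  have h1 : (2 : ℝ) ^ (-δ) < 1 := Real.rpow_lt_one_of_one_lt_of_neg (by norm_num) (by linarith)
  have h0 : (0 : ℝ) < 2 ^ (-δ) := by positivity
  have : HasSum (fun l : ℕ => 2 * (2 : ℝ) ^ (-δ * l)) (rejectionConst δ) := by
    simp_rw [Real.rpow_mul_natCast (show (0 : ℝ) ≤ 2 by norm_num)]
    exact (hasSum_geometric_of_lt_one h0.le h1).mul_left 2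
  rw [← this.tsum_eq, ENNReal.ofReal_tsum_of_nonneg (fun l => by positivity) this.summable]

/-- One-shot channel simulation with common randomness: the kernel `Q` can be simulated exactly
with a reference pmf `r`, at an expected logarithmic index cost controlled by the positive part
of the log-likelihood ratio. -/
lemma exists_channel_simulation {A B : Type} [Countable A] [MeasurableSpace A]
    [DiscreteMeasurableSpace A] [Countable B] [MeasurableSpace B] [DiscreteMeasurableSpace B]
    (Q : A → PMF B) (r : PMF B) {δ : ℝ} (hδ : 0 < δ) :
    ∃ (𝒵 : Type) (_ : MeasurableSpace 𝒵) (PZ : Measure 𝒵) (f : A × 𝒵 → ℕ) (g : ℕ × 𝒵 → B),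
      IsProbabilityMeasure PZ ∧ Measurable f ∧ Measurable g ∧
      ∀ x, (∀ y, Q x y ≠ 0 → r y ≠ 0) →
        (∀ y, PZ {z | g (f (x, z), z) = y} = Q x y) ∧
        ∫⁻ z, ENNReal.ofReal (Real.logb 2 (f (x, z) + 1)) ∂PZ ≤
          ENNReal.ofReal (1 + δ) * ∑' y, Q x y * (logRatioLevel (Q x) r y : ℝ≥0∞) +
            ENNReal.ofReal (rejectionConst δ) := by
  let ρ : Measure (B × unitInterval) := r.toMeasure.prod volume
  let lev : A → PMF ℕ := fun x => (Q x).map (logRatioLevel (Q x) r)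
  let PL : Measure (A → ℕ) := Measure.infinitePi fun x => (lev x).toMeasure
  let PW : Measure (ℕ → B × unitInterval) := Measure.infinitePi fun _ => ρ
  let f : A × ((A → ℕ) × (ℕ → B × unitInterval)) → ℕ :=
    fun a => firstHit (acceptSet (Q a.1) r (a.2.1 a.1)) a.2.2
  let g : ℕ × ((A → ℕ) × (ℕ → B × unitInterval)) → B := fun a => (a.2.2 a.1).1
  have hf : Measurable f := by
    refine measurable_from_prod_countable_right fun x => ?_
    have : Measurable fun q : ℕ × (ℕ → B × unitInterval) =>
        firstHit (acceptSet (Q x) r q.1) q.2 :=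
      measurable_from_prod_countable_right fun l =>
        measurable_firstHit (measurableSet_acceptSet (Q x) r l)
    exact this.comp (f := fun z : (A → ℕ) × (ℕ → B × unitInterval) => (z.1 x, z.2)) (by fun_prop)
  have hg : Measurable g := by
    refine measurable_from_prod_countable_right fun k => ?_
    show Measurable fun z : (A → ℕ) × (ℕ → B × unitInterval) => (z.2 k).1
    fun_prop
  have hgf (x : A) : Measurable fun z => g (f (x, z), z) := by fun_prop
  refine ⟨_, inferInstance, PL.prod PW, f, g, inferInstance, hf, hg, fun x hx => ⟨?_, ?_⟩⟩
  · refine PMF.eq_of_forall_le_of_tsum_le (fun y => ?_) ?_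
    · set l := logRatioLevel (Q x) r y with hl
      have hsub : {ζ : A → ℕ | ζ x = l} ×ˢ {w : ℕ → B × unitInterval |
            w (firstHit (acceptSet (Q x) r l) w) ∈ acceptSet (Q x) r l ∩ {w | w.1 = y}} ⊆
          {z | g (f (x, z), z) = y} := by
        rintro ⟨ζ, w⟩ ⟨h1, h2⟩
        have h1' : ζ x = l := h1
        simpa [f, g, h1'] using h2.2
      have hPL : PL {ζ | ζ x = l} = lev x l := by
        rw [← (lev x).toMeasure_apply_singleton l (.singleton l),
          ← Measure.infinitePi_map_eval (fun x => (lev x).toMeasure) x,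
          Measure.map_apply (measurable_pi_apply x) (.singleton l)]
        rfl
      refine le_trans ?_ (measure_mono hsub)
      rw [Measure.prod_prod, hPL]
      have hA := measurableSet_acceptSet (Q x) r l
      refine le_trans ?_ (mul_le_mul_right (div_le_infinitePi_firstHit_mem ρ hA
        (hA.inter (measurable_fst (.singleton y))) Set.inter_subset_left) _)
      have hAy : ρ (acceptSet (Q x) r l ∩ Prod.fst ⁻¹' {y}) = Q x y / 2 ^ l := by
        refine (prod_acceptSet_inter _ _ hx l y).trans ?_
        rw [mul_acceptProb _ _ hx, if_pos hl]
      have hAl : ρ (acceptSet (Q x) r l) = lev x l / 2 ^ l := prod_acceptSet _ _ hx l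
      rw [hAy, hAl]
      have hle : Q x y ≤ lev x l := by
        simp only [lev, PMF.map_apply]
        refine le_trans ?_ (ENNReal.le_tsum y)
        rw [if_pos hl]
      by_cases h0 : lev x l = 0
      · rw [h0] at hle
        simp [nonpos_iff_eq_zero.mp hle]
      have ht : lev x l ≠ ⊤ := (lev x).apply_ne_top l
      refine le_of_eq ?_
      simp only [div_eq_mul_inv]
      rw [ENNReal.mul_inv (Or.inl h0) (Or.inl ht), inv_inv]
      calc Q x y = (lev x l * (lev x l)⁻¹) * (((2 : ℝ≥0∞) ^ l)⁻¹ * 2 ^ l) * Q x y := by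
            rw [ENNReal.mul_inv_cancel h0 ht, ENNReal.inv_mul_cancel (by simp) (by simp)]
            simp
        _ = _ := by ring
    · have hm (y : B) : MeasurableSet {z | g (f (x, z), z) = y} := hgf x (.singleton y)
      rw [← measure_iUnion _ hm]
      · exact prob_le_one
      · intro i j hij
        exact Set.disjoint_left.mpr fun w hi hj => hij (hi.symm.trans hj)
  · let F : ℕ → ℝ≥0∞ := fun l => ENNReal.ofReal (1 + δ) * l +
      ENNReal.ofReal (2 * 2 ^ (-((1 + δ) * l))) * (lev x l / 2 ^ l)⁻¹
    have hinner (ζ : A → ℕ) :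
        ∫⁻ w, ENNReal.ofReal (Real.logb 2 (f (x, (ζ, w)) + 1)) ∂PW ≤ F (ζ x) := by
      set l := ζ x with hl
      have hA := measurableSet_acceptSet (Q x) r l
      calc ∫⁻ w, ENNReal.ofReal (Real.logb 2 (f (x, (ζ, w)) + 1)) ∂PW
          ≤ ∫⁻ w, (ENNReal.ofReal (1 + δ) * l + ENNReal.ofReal (2 * 2 ^ (-((1 + δ) * l))) *
              ((firstHit (acceptSet (Q x) r l) w : ℝ≥0∞) + 1)) ∂PW := by
            refine lintegral_mono fun w => ?_
            have h := logb_two_le_add ((1 + δ) * l)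
              (k := (firstHit (acceptSet (Q x) r l) w : ℝ) + 1) (by positivity)
            refine (ENNReal.ofReal_le_ofReal h).trans (le_of_eq ?_)
            have hadd : ENNReal.ofReal ((firstHit (acceptSet (Q x) r l) w : ℝ) + 1) =
                (firstHit (acceptSet (Q x) r l) w : ℝ≥0∞) + 1 := by
              rw [ENNReal.ofReal_add (by positivity) zero_le_one, ENNReal.ofReal_natCast,
                ENNReal.ofReal_one]
            rw [← hadd, ENNReal.ofReal_add (by positivity) (by positivity),
              ENNReal.ofReal_mul (p := 1 + δ) (by positivity), ENNReal.ofReal_natCast,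
              ENNReal.ofReal_mul (q := (firstHit (acceptSet (Q x) r l) w : ℝ) + 1)
                (by positivity)]
        _ ≤ _ := by
            rw [lintegral_add_left measurable_const, lintegral_const, measure_univ, mul_one,
              lintegral_const_mul]
            · refine add_le_add_right (mul_le_mul_right ?_ _) _
              refine (lintegral_firstHit_le ρ hA).trans (le_of_eq ?_)
              rw [prod_acceptSet _ _ hx]
            · have := measurable_firstHit hA
              fun_prop
    have hlog : Measurable fun z => ENNReal.ofReal (Real.logb 2 (f (x, z) + 1)) :=
      (Measurable.of_discrete (f := fun k : ℕ => ENNReal.ofReal (Real.logb 2 (k + 1)))).comp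
        (by fun_prop : Measurable fun z => f (x, z))
    rw [lintegral_prod _ hlog.aemeasurable]
    refine (lintegral_mono hinner).trans ?_
    have hmap : ∫⁻ ζ, F (ζ x) ∂PL = ∑' l, F l * lev x l := by
      rw [← lintegral_map (f := F) (g := fun ζ : A → ℕ => ζ x) .of_discrete (measurable_pi_apply x),
        Measure.infinitePi_map_eval, lintegral_countable']
      simp_rw [PMF.toMeasure_apply_singleton _ _ (MeasurableSet.singleton _)]
    have hlev : ∑' l : ℕ, (l : ℝ≥0∞) * lev x l =
        ∑' y, Q x y * (logRatioLevel (Q x) r y : ℝ≥0∞) := by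
      have h1 : ∫⁻ l, (l : ℝ≥0∞) ∂(lev x).toMeasure = ∑' l : ℕ, (l : ℝ≥0∞) * lev x l := by
        rw [lintegral_countable']
        simp_rw [PMF.toMeasure_apply_singleton _ _ (MeasurableSet.singleton _)]
      rw [← h1, ← PMF.toMeasure_map _ _ .of_discrete, lintegral_map .of_discrete .of_discrete,
        lintegral_countable']
      simp_rw [PMF.toMeasure_apply_singleton _ _ (MeasurableSet.singleton _), mul_comm]
    rw [hmap]
    simp only [F, add_mul]
    rw [ENNReal.tsum_add]
    refine add_le_add (le_of_eq ?_) ?_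
    · rw [← hlev, ← ENNReal.tsum_mul_left]
      simp_rw [mul_assoc]
    · rw [← tsum_rejectionConst hδ]
      refine ENNReal.tsum_le_tsum fun l => ?_
      have h2 : (lev x l / 2 ^ l)⁻¹ * lev x l ≤ 2 ^ l := by
        rw [ENNReal.inv_div (by simp) (by simp), mul_comm]
        exact ENNReal.mul_div_le
      rw [mul_assoc]
      refine (mul_le_mul_right h2 _).trans (le_of_eq ?_)
      have h3 : (2 : ℝ≥0∞) ^ l = ENNReal.ofReal (2 ^ (l : ℝ)) := by
        rw [Real.rpow_natCast, ENNReal.ofReal_pow (by norm_num)]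
        simp
      rw [h3, ← ENNReal.ofReal_mul (by positivity), mul_assoc,
        ← Real.rpow_add (by norm_num)]
      congr 3
      ring

end Rejection

section Entropy

lemma neg_mul_logb_nonneg {B : Type*} (p : PMF B) (y : B) :
    0 ≤ -((p y).toReal * Real.logb 2 (p y).toReal) := by
  have h1 : (p y).toReal ≤ 1 := by
    simpa using ENNReal.toReal_mono ENNReal.one_ne_top (p.coe_le_one y)
  have := Real.logb_nonpos (b := 2) (by norm_num) (ENNReal.toReal_nonneg (a := p y)) h1
  nlinarith [ENNReal.toReal_nonneg (a := p y)]

lemma ent2_nonneg {B : Type*} (p : PMF B) : 0 ≤ ent2 p :=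
  tsum_nonneg (neg_mul_logb_nonneg p)

/-- Gibbs' inequality: entropy is bounded by the mean length of any code satisfying Kraft's
inequality. -/
lemma ent2_le_tsum_of_kraft {B : Type*} (p : PMF B) (c : B → ℝ)
    (hk : Summable fun y => (2 : ℝ) ^ (-c y)) (hk1 : ∑' y, (2 : ℝ) ^ (-c y) ≤ 1)
    (hpc : Summable fun y => (p y).toReal * c y) :
    ent2 p ≤ ∑' y, (p y).toReal * c y := by
  have hlog : 0 < Real.log 2 := Real.log_pos (by norm_num)
  have hp : HasSum (fun y => (p y).toReal) 1 := by
    have := ENNReal.hasSum_toReal p.tsum_coe_ne_top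
    rwa [← ENNReal.tsum_toReal_eq fun y => p.apply_ne_top y, p.tsum_coe,
      ENNReal.toReal_one] at this
  have hpt (y : B) : -((p y).toReal * Real.logb 2 (p y).toReal) ≤
      (p y).toReal * c y + (Real.log 2)⁻¹ * ((2 : ℝ) ^ (-c y) - (p y).toReal) := by
    have h2 : (0 : ℝ) < 2 ^ (-c y) := by positivity
    rcases (ENNReal.toReal_nonneg (a := p y)).eq_or_lt with h0 | h0
    · rw [← h0]
      simp only [zero_mul, neg_zero, zero_add, sub_zero]
      positivity
    · set t := (p y).toReal
      have h3 : Real.logb 2 (2 ^ (-c y) / t) = -c y - Real.logb 2 t := by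
        rw [Real.logb_div h2.ne' h0.ne', Real.logb_rpow (by norm_num) (by norm_num)]
      have h4 : Real.logb 2 (2 ^ (-c y) / t) ≤ (Real.log 2)⁻¹ * (2 ^ (-c y) / t - 1) := by
        rw [Real.logb, div_eq_inv_mul]
        exact mul_le_mul_of_nonneg_left (Real.log_le_sub_one_of_pos (by positivity)) (by positivity)
      have h5 : t * ((Real.log 2)⁻¹ * (2 ^ (-c y) / t - 1)) = (Real.log 2)⁻¹ * (2 ^ (-c y) - t) := by
        field_simp
      have h6 := mul_le_mul_of_nonneg_left (h3 ▸ h4) h0.le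
      rw [h5] at h6
      linarith
  have hs : Summable fun y => (Real.log 2)⁻¹ * ((2 : ℝ) ^ (-c y) - (p y).toReal) :=
    (hk.sub hp.summable).mul_left _
  have hle := Summable.tsum_le_tsum hpt (.of_nonneg_of_le (neg_mul_logb_nonneg p) hpt (hpc.add hs)) (hpc.add hs)
  rw [hpc.tsum_add hs, tsum_mul_left, hk.tsum_sub hp.summable, hp.tsum_eq] at hle
  have : (Real.log 2)⁻¹ * (∑' y, (2 : ℝ) ^ (-c y) - 1) ≤ 0 :=
    mul_nonpos_of_nonneg_of_nonpos (by positivity) (by linarith)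
  exact hle.trans (by linarith)

/-- Normalizing constant of the power-law code on `ℕ`. -/
noncomputable def powerCodeConst (δ : ℝ) : ℝ :=
  Real.logb 2 (∑' k : ℕ, 1 / ((k : ℝ) + 1) ^ (1 + δ))

/-- Ideal code length `(1 + δ) log₂ (k + 1) + const` on `ℕ`. -/
noncomputable def powerCode (δ : ℝ) (k : ℕ) : ℝ :=
  (1 + δ) * Real.logb 2 (k + 1) + powerCodeConst δ

lemma summable_powerLaw {δ : ℝ} (hδ : 0 < δ) :
    Summable fun k : ℕ => 1 / ((k : ℝ) + 1) ^ (1 + δ) := by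
  have := (summable_nat_add_iff 1).mpr
    (Real.summable_one_div_nat_rpow.mpr (by linarith : 1 < 1 + δ))
  simpa using this

lemma one_le_tsum_powerLaw {δ : ℝ} (hδ : 0 < δ) :
    1 ≤ ∑' k : ℕ, 1 / ((k : ℝ) + 1) ^ (1 + δ) := by
  have := (summable_powerLaw hδ).le_tsum 0 fun k _ => by positivity
  simpa using this

lemma powerCodeConst_nonneg {δ : ℝ} (hδ : 0 < δ) : 0 ≤ powerCodeConst δ :=
  Real.logb_nonneg (by norm_num) (one_le_tsum_powerLaw hδ)

lemma powerCode_nonneg {δ : ℝ} (hδ : 0 < δ) (k : ℕ) : 0 ≤ powerCode δ k := by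
  have h1 : 0 ≤ Real.logb 2 ((k : ℝ) + 1) :=
    Real.logb_nonneg (by norm_num) (by linarith [(Nat.cast_nonneg k : (0 : ℝ) ≤ k)])
  have := powerCodeConst_nonneg hδ
  unfold powerCode
  positivity

lemma hasSum_two_rpow_neg_powerCode {δ : ℝ} (hδ : 0 < δ) :
    HasSum (fun k => (2 : ℝ) ^ (-powerCode δ k)) 1 := by
  set S := ∑' k : ℕ, 1 / ((k : ℝ) + 1) ^ (1 + δ) with hS
  have hS0 : 0 < S := lt_of_lt_of_le one_pos (one_le_tsum_powerLaw hδ)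
  have h := (summable_powerLaw hδ).hasSum.mul_right S⁻¹
  rw [← hS, mul_inv_cancel₀ hS0.ne'] at h
  refine h.congr_fun fun k => ?_
  have hk : (0 : ℝ) < (k : ℝ) + 1 := by positivity
  rw [powerCode, powerCodeConst, ← hS, neg_add, Real.rpow_add (by norm_num),
    Real.rpow_neg (by norm_num) (Real.logb 2 S), Real.rpow_logb (by norm_num) (by norm_num) hS0,
    Real.rpow_neg (by norm_num), mul_comm (1 + δ), Real.rpow_mul (by norm_num),
    Real.rpow_logb (by norm_num) (by norm_num) hk, one_div]

variable {A : Type*} [Countable A] [MeasurableSpace A] [DiscreteMeasurableSpace A]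
  {𝒵 : Type*} [MeasurableSpace 𝒵]

/-- The conditional law of `f (X, Z)` given `Z` when `X ∼ PX` is independent of `Z`. -/
lemma isCondDistrib_map (PX : PMF A) (PZ : Measure 𝒵) [IsProbabilityMeasure PZ]
    {f : A × 𝒵 → ℕ} (hf : Measurable f) :
    IsCondDistrib (PX.toMeasure.prod PZ) (fun ω => f ω) Prod.snd
      (fun z => PX.map fun x => f (x, z)) := by
  classical
  have happ (z : 𝒵) (k : ℕ) :
      PX.map (fun x => f (x, z)) k = PX.toMeasure {x | f (x, z) = k} := by
    rw [← PMF.toMeasure_apply_singleton _ k (.singleton k),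
      PMF.toMeasure_map_apply _ _ _ .of_discrete (.singleton k)]
    rfl
  refine ⟨fun k => ?_, fun k S hS => ?_⟩
  · simp_rw [happ]
    exact measurable_measure_prodMk_right (hf (.singleton k))
  · have hset : {ω : A × 𝒵 | f ω = k ∧ ω.2 ∈ S} = f ⁻¹' {k} ∩ Prod.snd ⁻¹' S := rfl
    rw [Measure.map_snd_prod, measure_univ, one_smul, hset,
      Measure.prod_apply_symm ((hf (.singleton k)).inter (measurable_snd hS)),
      ← lintegral_indicator hS]
    refine lintegral_congr fun z => ?_
    by_cases hz : z ∈ S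
    · rw [Set.indicator_of_mem hz, happ]
      congr 1
      ext x
      simp [hz]
    · rw [Set.indicator_of_notMem hz]
      simp [Set.preimage, hz]

lemma integral_ent2_map_le (PX : PMF A) (PZ : Measure 𝒵) [IsProbabilityMeasure PZ]
    {f : A × 𝒵 → ℕ} (hf : Measurable f) {δ : ℝ} (hδ : 0 < δ) {K : ℝ} (hK : 0 ≤ K)
    (hle : ∑' x, PX x * ∫⁻ z, ENNReal.ofReal (powerCode δ (f (x, z))) ∂PZ ≤ ENNReal.ofReal K) :
    ∫ z, ent2 (PX.map fun x => f (x, z)) ∂PZ ≤ K := by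
  let G : 𝒵 → ℝ≥0∞ := fun z => ∑' x, PX x * ENNReal.ofReal (powerCode δ (f (x, z)))
  have hcost (x : A) : Measurable fun z => ENNReal.ofReal (powerCode δ (f (x, z))) :=
    (Measurable.of_discrete (f := fun k => ENNReal.ofReal (powerCode δ k))).comp
      (by fun_prop : Measurable fun z => f (x, z))
  have hGm : Measurable G := Measurable.tsum fun x => (hcost x).const_mul _
  have hG : ∫⁻ z, G z ∂PZ ≤ ENNReal.ofReal K := by
    rw [lintegral_tsum fun x => ((hcost x).const_mul _).aemeasurable]
    exact (tsum_congr fun x => lintegral_const_mul (PX x) (hcost x)).trans_le hle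
  have hGt : ∫⁻ z, G z ∂PZ ≠ ⊤ := ne_top_of_le_ne_top ENNReal.ofReal_ne_top hG
  have hent : ∀ᵐ z ∂PZ, ent2 (PX.map fun x => f (x, z)) ≤ (G z).toReal := by
    filter_upwards [ae_lt_top hGm hGt] with z hz
    set p := PX.map fun x => f (x, z) with hp
    have hsum : G z = ∑' k, p k * ENNReal.ofReal (powerCode δ k) := by
      have h1 : ∑' k, p k * ENNReal.ofReal (powerCode δ k) =
          ∫⁻ k, ENNReal.ofReal (powerCode δ k) ∂p.toMeasure := by
        rw [lintegral_countable']
        simp_rw [PMF.toMeasure_apply_singleton _ _ (MeasurableSet.singleton _), mul_comm]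
      rw [h1, hp, ← PMF.toMeasure_map _ _ .of_discrete, lintegral_map .of_discrete .of_discrete,
        lintegral_countable']
      simp_rw [PMF.toMeasure_apply_singleton _ _ (MeasurableSet.singleton _), G, mul_comm]
    have hterm (k : ℕ) : (p k * ENNReal.ofReal (powerCode δ k)).toReal =
        (p k).toReal * powerCode δ k := by
      rw [ENNReal.toReal_mul, ENNReal.toReal_ofReal (powerCode_nonneg hδ k)]
    have hne : ∑' k, p k * ENNReal.ofReal (powerCode δ k) ≠ ⊤ := hsum ▸ hz.ne
    have hs : Summable fun k => (p k).toReal * powerCode δ k := by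
      simpa only [hterm] using ENNReal.summable_toReal hne
    have hkraft := hasSum_two_rpow_neg_powerCode hδ
    refine (ent2_le_tsum_of_kraft p _ hkraft.summable hkraft.tsum_eq.le hs).trans (le_of_eq ?_)
    rw [hsum, ENNReal.tsum_toReal_eq fun k => ENNReal.ne_top_of_tsum_ne_top hne k]
    simp_rw [hterm]
  calc ∫ z, ent2 (PX.map fun x => f (x, z)) ∂PZ ≤ ∫ z, (G z).toReal ∂PZ :=
        integral_mono_of_nonneg (.of_forall fun z => ent2_nonneg _)
          (integrable_toReal_of_lintegral_ne_top hGm.aemeasurable hGt) hent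
    _ = (∫⁻ z, G z ∂PZ).toReal :=
        integral_toReal hGm.aemeasurable (ae_lt_top hGm hGt)
    _ ≤ K := by
        rw [← ENNReal.toReal_ofReal hK]
        exact ENNReal.toReal_mono ENNReal.ofReal_ne_top hG

end Entropy

section ProductPMF

variable {α : Type*} [Countable α] [MeasurableSpace α] [DiscreteMeasurableSpace α] {N : ℕ}

/-- Product of finitely many pmfs. -/
noncomputable def productPMF (p : Fin N → PMF α) : PMF (Fin N → α) :=
  (Measure.pi fun j => (p j).toMeasure).toPMF

lemma productPMF_apply (p : Fin N → PMF α) (v : Fin N → α) :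
    productPMF p v = ∏ j, p j (v j) := by
  rw [productPMF, Measure.toPMF_apply, Measure.pi_singleton]
  simp_rw [PMF.toMeasure_apply_singleton _ _ (MeasurableSet.singleton _)]

lemma toMeasure_productPMF (p : Fin N → PMF α) :
    (productPMF p).toMeasure = Measure.pi fun j => (p j).toMeasure :=
  Measure.toPMF_toMeasure _

end ProductPMF

section Source

variable {𝒳 𝒴 : Type*}

lemma jointPMF_apply (μ : PMF 𝒳) (Q : 𝒳 → PMF 𝒴) (p : 𝒳 × 𝒴) :
    jointPMF μ Q p = μ p.1 * Q p.1 p.2 := by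
  classical
  obtain ⟨a, b⟩ := p
  have h (x : 𝒳) : (Q x).map (Prod.mk x) (a, b) = if x = a then Q a b else 0 := by
    rw [PMF.map_apply]
    by_cases hx : x = a
    · subst hx
      rw [if_pos rfl]
      exact (tsum_eq_single b fun y hy => if_neg (by simpa using Ne.symm hy)).trans (by simp)
    · simp [hx, Ne.symm hx]
  rw [jointPMF, PMF.bind_apply, tsum_eq_single a fun x hx => by simp [h, hx]]
  simp [h]

lemma bind_ne_zero_of_jointPMF_ne_zero {μ : PMF 𝒳} {Q : 𝒳 → PMF 𝒴} {p : 𝒳 × 𝒴}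
    (hp : jointPMF μ Q p ≠ 0) : Q p.1 p.2 ≠ 0 ∧ μ.bind Q p.2 ≠ 0 := by
  rw [jointPMF_apply] at hp
  refine ⟨right_ne_zero_of_mul hp, ?_⟩
  rw [PMF.bind_apply]
  exact ne_of_gt (lt_of_lt_of_le (pos_iff_ne_zero.mpr hp) (ENNReal.le_tsum p.1))

/-- Information density `log₂ (Q(y|x) / q(y))`. -/
noncomputable def infoDensity (μ : PMF 𝒳) (Q : 𝒳 → PMF 𝒴) (p : 𝒳 × 𝒴) : ℝ :=
  Real.logb 2 ((Q p.1 p.2).toReal / ((μ.bind Q) p.2).toReal)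

lemma two_rpow_infoDensity {μ : PMF 𝒳} {Q : 𝒳 → PMF 𝒴} {p : 𝒳 × 𝒴}
    (hp : jointPMF μ Q p ≠ 0) :
    (2 : ℝ) ^ infoDensity μ Q p = (Q p.1 p.2).toReal / ((μ.bind Q) p.2).toReal := by
  obtain ⟨h1, h2⟩ := bind_ne_zero_of_jointPMF_ne_zero hp
  have := ENNReal.toReal_pos h1 ((Q p.1).apply_ne_top _)
  have := ENNReal.toReal_pos h2 ((μ.bind Q).apply_ne_top _)
  exact Real.rpow_logb (by norm_num) (by norm_num) (by positivity)

variable {N : ℕ} [Countable 𝒴] [MeasurableSpace 𝒴] [DiscreteMeasurableSpace 𝒴]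

/-- The level of a block is controlled by the sum of the information densities. -/
lemma logRatioLevel_productPMF_le {μ : PMF 𝒳} {Q : 𝒳 → PMF 𝒴} {r : PMF (Fin N → 𝒴)} {m : ℝ}
    (hm : 1 ≤ m)
    (hr : ∀ y, (productPMF (fun _ : Fin N => μ.bind Q) y).toReal ≤ m * (r y).toReal)
    {v : Fin N → 𝒳 × 𝒴} (hv : ∀ j, jointPMF μ Q (v j) ≠ 0) :
    (logRatioLevel (productPMF fun j => Q (v j).1) r (fun j => (v j).2) : ℝ) ≤
      ∑ j, infoDensity μ Q (v j) + 2 * ∏ j, (2 : ℝ) ^ (-infoDensity μ Q (v j)) +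
        (Real.logb 2 m + 1) := by
  set ψ := ∑ j, infoDensity μ Q (v j) with hψ
  have hprod : ∏ j, (2 : ℝ) ^ (-infoDensity μ Q (v j)) = 2 ^ (-ψ) := by
    rw [← Real.rpow_sum_of_pos (by norm_num), hψ, Finset.sum_neg_distrib]
  have hpos : 0 ≤ ψ + 2 * 2 ^ (-ψ) := by
    have := logb_two_le_add 0 (k := 2 ^ (-ψ)) (by positivity)
    rw [Real.logb_rpow (by norm_num) (by norm_num)] at this
    simp only [neg_zero, Real.rpow_zero] at this
    linarith
  have hlogm : 0 ≤ Real.logb 2 m := Real.logb_nonneg (by norm_num) hm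
  have hQ (j : Fin N) : 0 < (Q (v j).1 (v j).2).toReal :=
    ENNReal.toReal_pos (bind_ne_zero_of_jointPMF_ne_zero (hv j)).1 ((Q _).apply_ne_top _)
  have hq (j : Fin N) : 0 < (μ.bind Q (v j).2).toReal :=
    ENNReal.toReal_pos (bind_ne_zero_of_jointPMF_ne_zero (hv j)).2 ((μ.bind Q).apply_ne_top _)
  have hry := hr fun j => (v j).2
  simp only [productPMF_apply, ENNReal.toReal_prod] at hry
  have hq' : 0 < ∏ j, (μ.bind Q (v j).2).toReal := Finset.prod_pos fun j _ => hq j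
  have hQ' : 0 < ∏ j, (Q (v j).1 (v j).2).toReal := Finset.prod_pos fun j _ => hQ j
  have hr0 : 0 < (r fun j => (v j).2).toReal := by
    by_contra! h
    nlinarith
  have hratio : Real.logb 2 ((productPMF (fun j => Q (v j).1) fun j => (v j).2).toReal /
      (r fun j => (v j).2).toReal) ≤ ψ + Real.logb 2 m := by
    have h2ψ : (2 : ℝ) ^ ψ =
        (∏ j, (Q (v j).1 (v j).2).toReal) / ∏ j, (μ.bind Q (v j).2).toReal := by
      rw [hψ, Real.rpow_sum_of_pos (by norm_num), ← Finset.prod_div_distrib]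
      exact Finset.prod_congr rfl fun j _ => two_rpow_infoDensity (hv j)
    rw [productPMF_apply, ENNReal.toReal_prod, Real.logb_le_iff_le_rpow (by norm_num)
      (by positivity), Real.rpow_add (by norm_num), h2ψ,
      Real.rpow_logb (by norm_num) (by norm_num) (by linarith), div_mul_eq_mul_div,
      div_le_div_iff₀ hr0 hq', mul_assoc]
    exact mul_le_mul_of_nonneg_left hry hQ'.le
  rw [hprod, logRatioLevel]
  have hceil : ∀ t b : ℝ, t ≤ b → 0 ≤ b → (⌈t⌉₊ : ℝ) ≤ b + 1 := fun t b ht hb =>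
    (Nat.cast_le.mpr (Nat.ceil_mono ht)).trans (Nat.ceil_lt_add_one hb).le
  have := hceil _ _ (hratio.trans (b := ψ + Real.logb 2 m)
    (c := ψ + 2 * 2 ^ (-ψ) + Real.logb 2 m) (by
      have : (0 : ℝ) < 2 ^ (-ψ) := by positivity
      linarith)) (by linarith)
  linarith

variable [Countable 𝒳] [MeasurableSpace 𝒳] [DiscreteMeasurableSpace 𝒳]

lemma PMF.toMeasure_singleton {α : Type*} [MeasurableSpace α] [DiscreteMeasurableSpace α]
    (p : PMF α) (a : α) : p.toMeasure {a} = p a :=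
  p.toMeasure_apply_singleton a (.singleton a)

lemma integrable_infoDensity {μ : PMF 𝒳} {Q : 𝒳 → PMF 𝒴} (hs : Summable (miSummand μ Q)) :
    Integrable (infoDensity μ Q) (jointPMF μ Q).toMeasure := by
  refine ⟨Measurable.of_discrete.aestronglyMeasurable, ?_⟩
  rw [HasFiniteIntegral, lintegral_countable']
  have h (p : 𝒳 × 𝒴) : ‖infoDensity μ Q p‖ₑ * (jointPMF μ Q).toMeasure {p} =
      ENNReal.ofReal |miSummand μ Q p| := by
    rw [PMF.toMeasure_singleton, jointPMF_apply, Real.enorm_eq_ofReal_abs, miSummand, abs_mul,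
      abs_of_nonneg ENNReal.toReal_nonneg, ENNReal.ofReal_mul ENNReal.toReal_nonneg,
      ENNReal.ofReal_toReal (ENNReal.mul_ne_top (μ.apply_ne_top _) ((Q _).apply_ne_top _)),
      mul_comm]
    rfl
  simp_rw [h]
  rw [← ENNReal.ofReal_tsum_of_nonneg (fun _ => abs_nonneg _) hs.abs]
  exact ENNReal.ofReal_lt_top

lemma integral_infoDensity {μ : PMF 𝒳} {Q : 𝒳 → PMF 𝒴} (hs : Summable (miSummand μ Q)) :
    ∫ p, infoDensity μ Q p ∂(jointPMF μ Q).toMeasure = mutInfo μ Q := by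
  rw [PMF.integral_eq_tsum _ _ (integrable_infoDensity hs)]
  simp_rw [jointPMF_apply]
  rfl

lemma lintegral_two_rpow_neg_infoDensity_le (μ : PMF 𝒳) (Q : 𝒳 → PMF 𝒴) :
    ∫⁻ p, ENNReal.ofReal (2 ^ (-infoDensity μ Q p)) ∂(jointPMF μ Q).toMeasure ≤ 1 := by
  rw [lintegral_countable']
  calc _ ≤ ∑' p : 𝒳 × 𝒴, μ p.1 * (μ.bind Q) p.2 := by
        refine ENNReal.tsum_le_tsum fun p => ?_
        rw [PMF.toMeasure_singleton]
        by_cases hp : jointPMF μ Q p = 0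
        · simp [hp]
        obtain ⟨h1, h2⟩ := bind_ne_zero_of_jointPMF_ne_zero hp
        have h1' := (Q p.1).apply_ne_top p.2
        have h3 := ENNReal.toReal_pos h1 h1'
        rw [Real.rpow_neg (by norm_num), two_rpow_infoDensity hp, inv_div,
          ENNReal.ofReal_div_of_pos h3, ENNReal.ofReal_toReal ((μ.bind Q).apply_ne_top _),
          ENNReal.ofReal_toReal h1', jointPMF_apply, mul_comm, mul_assoc,
          ENNReal.mul_div_cancel h1 h1']
    _ = 1 := by
        rw [ENNReal.tsum_prod']
        simp_rw [ENNReal.tsum_mul_left, PMF.tsum_coe, mul_one, PMF.tsum_coe]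

lemma integrable_two_rpow_neg_infoDensity (μ : PMF 𝒳) (Q : 𝒳 → PMF 𝒴) :
    Integrable (fun p => (2 : ℝ) ^ (-infoDensity μ Q p)) (jointPMF μ Q).toMeasure := by
  refine ⟨Measurable.of_discrete.aestronglyMeasurable, ?_⟩
  rw [hasFiniteIntegral_iff_ofReal (.of_forall fun p => by positivity)]
  exact (lintegral_two_rpow_neg_infoDensity_le μ Q).trans_lt ENNReal.one_lt_top

lemma integral_two_rpow_neg_infoDensity_le (μ : PMF 𝒳) (Q : 𝒳 → PMF 𝒴) :
    ∫ p, (2 : ℝ) ^ (-infoDensity μ Q p) ∂(jointPMF μ Q).toMeasure ≤ 1 := by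
  rw [integral_eq_lintegral_of_nonneg_ae (.of_forall fun p => by positivity)
    Measurable.of_discrete.aestronglyMeasurable]
  simpa using ENNReal.toReal_mono ENNReal.one_ne_top (lintegral_two_rpow_neg_infoDensity_le μ Q)

lemma mutInfo_nonneg {μ : PMF 𝒳} {Q : 𝒳 → PMF 𝒴} (hs : Summable (miSummand μ Q)) :
    0 ≤ mutInfo μ Q := by
  have h : ∫ p, 1 - Real.log 2 * infoDensity μ Q p ∂(jointPMF μ Q).toMeasure ≤
      ∫ p, (2 : ℝ) ^ (-infoDensity μ Q p) ∂(jointPMF μ Q).toMeasure := by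
    refine integral_mono ((integrable_const _).sub ((integrable_infoDensity hs).const_mul _))
      (integrable_two_rpow_neg_infoDensity μ Q) fun p => ?_
    have := Real.add_one_le_exp (Real.log 2 * -infoDensity μ Q p)
    rw [← Real.rpow_def_of_pos two_pos] at this
    linarith
  rw [integral_sub (integrable_const _) ((integrable_infoDensity hs).const_mul _),
    integral_const_mul, integral_infoDensity hs] at h
  have h1 := integral_two_rpow_neg_infoDensity_le μ Q
  simp only [integral_const, probReal_univ, one_smul] at h
  have h2 := Real.log_pos one_lt_two
  by_contra! h0
  nlinarith

lemma pi_jointPMF_singleton (μ : PMF 𝒳) (Q : 𝒳 → PMF 𝒴) (a : Fin N → 𝒳) (b : Fin N → 𝒴) :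
    (Measure.pi fun _ : Fin N => (jointPMF μ Q).toMeasure) {fun j => (a j, b j)} =
      productPMF (fun _ => μ) a * productPMF (fun j => Q (a j)) b := by
  rw [Measure.pi_singleton]
  simp_rw [PMF.toMeasure_singleton, jointPMF_apply, productPMF_apply, Finset.prod_mul_distrib]

lemma tsum_productPMF_mul (μ : PMF 𝒳) (Q : 𝒳 → PMF 𝒴)
    (F : (Fin N → 𝒳) → (Fin N → 𝒴) → ℝ≥0∞) :
    ∑' x, productPMF (fun _ : Fin N => μ) x * ∑' y, productPMF (fun j => Q (x j)) y * F x y =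
      ∫⁻ v, F (fun j => (v j).1) (fun j => (v j).2)
        ∂Measure.pi fun _ : Fin N => (jointPMF μ Q).toMeasure := by
  rw [lintegral_countable', ← (Equiv.arrowProdEquivProdArrow (Fin N) (fun _ => 𝒳)
    (fun _ => 𝒴)).symm.tsum_eq, ENNReal.tsum_prod']
  refine tsum_congr fun x => ?_
  rw [← ENNReal.tsum_mul_left]
  refine tsum_congr fun y => ?_
  have := pi_jointPMF_singleton μ Q x y
  simp only [Equiv.arrowProdEquivProdArrow, Equiv.coe_fn_symm_mk]
  rw [this]
  ring

/-- Mean level of a memoryless block with respect to a reference pmf dominating, up to a constant,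
the product of the output marginals. -/
lemma tsum_logRatioLevel_le {μ : PMF 𝒳} {Q : 𝒳 → PMF 𝒴} (hs : Summable (miSummand μ Q))
    {r : PMF (Fin N → 𝒴)} {m : ℝ} (hm : 1 ≤ m)
    (hr : ∀ y, (productPMF (fun _ : Fin N => μ.bind Q) y).toReal ≤ m * (r y).toReal) :
    ∑' x, productPMF (fun _ : Fin N => μ) x * ∑' y, productPMF (fun j => Q (x j)) y *
      (logRatioLevel (productPMF fun j => Q (x j)) r y : ℝ≥0∞) ≤
      ENNReal.ofReal (N * mutInfo μ Q + (Real.logb 2 m + 3)) := by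
  set π := Measure.pi fun _ : Fin N => (jointPMF μ Q).toMeasure
  have hae : ∀ᵐ v ∂π, ∀ j, jointPMF μ Q (v j) ≠ 0 := by
    rw [ae_iff_of_countable]
    intro v hv j hj
    refine hv ?_
    rw [Measure.pi_singleton]
    refine Finset.prod_eq_zero (Finset.mem_univ j) ?_
    rw [PMF.toMeasure_singleton, hj]
  have hint1 (j : Fin N) : Integrable (fun v => infoDensity μ Q (v j)) π :=
    integrable_comp_eval (i := j) (integrable_infoDensity hs)
  have hint2 : Integrable (fun v : Fin N → 𝒳 × 𝒴 =>
      ∏ j, (2 : ℝ) ^ (-infoDensity μ Q (v j))) π :=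
    Integrable.fintype_prod fun _ => integrable_two_rpow_neg_infoDensity μ Q
  have hint3 : Integrable (fun v => ∑ j, infoDensity μ Q (v j)) π :=
    integrable_finsetSum _ fun j _ => hint1 j
  have hI1 : ∫ v, ∑ j, infoDensity μ Q (v j) ∂π = N * mutInfo μ Q := by
    rw [integral_finsetSum _ fun j _ => hint1 j]
    have (j : Fin N) : ∫ v, infoDensity μ Q (v j) ∂π = mutInfo μ Q := by
      rw [← integral_infoDensity hs]
      exact integral_comp_eval (X := fun _ : Fin N => 𝒳 × 𝒴) (i := j) (f := infoDensity μ Q)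
        Measurable.of_discrete.aestronglyMeasurable
    simp [this]
  have hI2 : ∫ v, ∏ j, (2 : ℝ) ^ (-infoDensity μ Q (v j)) ∂π ≤ 1 := by
    rw [integral_fintype_prod_eq_prod (fun (_ : Fin N) p => (2 : ℝ) ^ (-infoDensity μ Q p))]
    exact Finset.prod_le_one (fun _ _ => integral_nonneg fun p => by positivity)
      fun _ _ => integral_two_rpow_neg_infoDensity_le μ Q
  rw [tsum_productPMF_mul]
  have hle := hae.mono fun v hv => logRatioLevel_productPMF_le hm hr hv
  have hint4 : Integrable (fun v => ∑ j, infoDensity μ Q (v j) +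
      2 * ∏ j, (2 : ℝ) ^ (-infoDensity μ Q (v j))) π := hint3.add (hint2.const_mul 2)
  have hint : Integrable (fun v => ∑ j, infoDensity μ Q (v j) +
      2 * ∏ j, (2 : ℝ) ^ (-infoDensity μ Q (v j)) + (Real.logb 2 m + 1)) π :=
    hint4.add (integrable_const _)
  calc _ ≤ ∫⁻ v, ENNReal.ofReal (∑ j, infoDensity μ Q (v j) +
          2 * ∏ j, (2 : ℝ) ^ (-infoDensity μ Q (v j)) + (Real.logb 2 m + 1)) ∂π := by
        refine lintegral_mono_ae (hle.mono fun v hv => ?_)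
        rw [← ENNReal.ofReal_natCast]
        exact ENNReal.ofReal_le_ofReal hv
    _ = ENNReal.ofReal (∫ v, (∑ j, infoDensity μ Q (v j) +
          2 * ∏ j, (2 : ℝ) ^ (-infoDensity μ Q (v j)) + (Real.logb 2 m + 1)) ∂π) :=
        (ofReal_integral_eq_lintegral_ofReal hint
          (hle.mono fun v hv => (Nat.cast_nonneg _).trans hv)).symm
    _ ≤ _ := by
        refine ENNReal.ofReal_le_ofReal ?_
        rw [integral_add hint4 (integrable_const _),
          integral_add hint3 (hint2.const_mul 2), integral_const_mul, hI1]
        simp only [integral_const, probReal_univ, one_smul]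
        linarith

/-- If the decoder output has conditional law `∏ Q(·|x_j)` given the source block, each
coordinate pair has joint pmf `μ ⊗ Q`. -/
lemma map_coordinate_eq_jointPMF {𝒵 : Type*} [MeasurableSpace 𝒵] (μ : PMF 𝒳) (Q : 𝒳 → PMF 𝒴)
    (PZ : Measure 𝒵) [IsProbabilityMeasure PZ] {G : (Fin N → 𝒳) × 𝒵 → Fin N → 𝒴}
    (hG : Measurable G)
    (hlaw : ∀ x, productPMF (fun _ : Fin N => μ) x ≠ 0 → ∀ y,
      PZ {z | G (x, z) = y} = productPMF (fun j => Q (x j)) y) (j : Fin N) :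
    ((Measure.pi fun _ : Fin N => μ.toMeasure).prod PZ).map (fun ω => (ω.1 j, G ω j)) =
      (jointPMF μ Q).toMeasure := by
  have hblock : ((Measure.pi fun _ : Fin N => μ.toMeasure).prod PZ).map (fun ω => (ω.1, G ω)) =
      (Measure.pi fun _ : Fin N => (jointPMF μ Q).toMeasure).map
        (fun v => (fun j => (v j).1, fun j => (v j).2)) := by
    refine Measure.ext_of_singleton fun ⟨a, b⟩ => ?_
    rw [Measure.map_apply (by fun_prop) (.singleton _),
      Measure.map_apply .of_discrete (.singleton _)]
    have h1 : (fun ω : (Fin N → 𝒳) × 𝒵 => (ω.1, G ω)) ⁻¹' {(a, b)} =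
        {a} ×ˢ {z | G (a, z) = b} := by
      ext ⟨x, z⟩
      simp only [Set.mem_preimage, Set.mem_singleton_iff, Prod.mk.injEq, Set.mem_prod,
        Set.mem_ofPred_eq]
      constructor
      · rintro ⟨rfl, h⟩; exact ⟨rfl, h⟩
      · rintro ⟨rfl, h⟩; exact ⟨rfl, h⟩
    have h2 : (fun v : Fin N → 𝒳 × 𝒴 => ((fun j => (v j).1, fun j => (v j).2) :
        (Fin N → 𝒳) × (Fin N → 𝒴))) ⁻¹' {(a, b)} = {fun j => (a j, b j)} := by
      ext v
      simp [funext_iff, Prod.ext_iff, forall_and]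
    rw [h1, h2, pi_jointPMF_singleton, Measure.prod_prod, ← toMeasure_productPMF,
      PMF.toMeasure_singleton]
    by_cases ha : productPMF (fun _ : Fin N => μ) a = 0
    · simp [ha]
    · rw [hlaw a ha]
  have := congrArg (Measure.map fun p : (Fin N → 𝒳) × (Fin N → 𝒴) => (p.1 j, p.2 j)) hblock
  rw [Measure.map_map .of_discrete (by fun_prop), Measure.map_map .of_discrete .of_discrete] at this
  refine this.trans ?_
  exact (measurePreserving_eval (fun _ : Fin N => (jointPMF μ Q).toMeasure) j).map_eq

end Source

/-- Uniform mixture of the memoryless output laws of a finite family of sources. -/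
noncomputable def mixtureOutput {𝒳 𝒴 ι : Type*} [Countable 𝒴] [MeasurableSpace 𝒴]
    [DiscreteMeasurableSpace 𝒴] [Fintype ι] [Nonempty ι] (μS : ι → PMF 𝒳) (Q : 𝒳 → PMF 𝒴)
    (N : ℕ) : PMF (Fin N → 𝒴) :=
  (PMF.uniformOfFintype ι).bind fun α => productPMF fun _ => (μS α).bind Q

lemma productPMF_le_mixtureOutput {𝒳 𝒴 ι : Type*} [Countable 𝒴] [MeasurableSpace 𝒴]
    [DiscreteMeasurableSpace 𝒴] [Fintype ι] [Nonempty ι] (μS : ι → PMF 𝒳) (Q : 𝒳 → PMF 𝒴)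
    {N : ℕ} (α : ι) (y : Fin N → 𝒴) :
    productPMF (fun _ => (μS α).bind Q) y ≤ Fintype.card ι * mixtureOutput μS Q N y := by
  have h : (Fintype.card ι : ℝ≥0∞)⁻¹ * productPMF (fun _ => (μS α).bind Q) y ≤
      mixtureOutput μS Q N y := by
    rw [mixtureOutput, PMF.bind_apply]
    refine le_trans (le_of_eq ?_) (ENNReal.le_tsum α)
    rw [PMF.uniformOfFintype_apply]
  calc _ = (Fintype.card ι : ℝ≥0∞) * ((Fintype.card ι : ℝ≥0∞)⁻¹ *
        productPMF (fun _ => (μS α).bind Q) y) := by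
          rw [← mul_assoc, ENNReal.mul_inv_cancel (by simp) (by simp), one_mul]
    _ ≤ _ := mul_le_mul_right h _

/-- **Asymptotic achievability for the robust information rate function.**
For a finite family of sources, a finite family of fidelity constraints with levels `θ`,
and a feasible robust information rate function `R̄(θ)`: for every `ε > 0` there is `N₀`
such that for all `N ≥ N₀` there are a source of common randomness `Z ∼ PZ`, a measurable
encoder `f_N` and a measurable decoder `g_N` such that for every source `μ_α` of the family,
taking `X^N` i.i.d. `∼ μ_α` independent of `Z` (the two coordinates of the product space),
`M = f_N(X^N, Z)` and `Y^N = g_N(M, Z)`, one has `H(M | Z) ≤ N (R̄(θ) + ε)` and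
`h_i(P_{X_j, Y_j}) ≤ θ_i` for all `i` and every coordinate `j`. -/
theorem robust_asymptotic_achievability
    {𝒳 𝒴 : Type} [Countable 𝒳] [Countable 𝒴]
    [MeasurableSpace 𝒳] [DiscreteMeasurableSpace 𝒳]
    [MeasurableSpace 𝒴] [DiscreteMeasurableSpace 𝒴]
    {ι : Type} [Fintype ι] [Nonempty ι] {M : ℕ}
    (μS : ι → PMF 𝒳) (h : Fin M → PMF (𝒳 × 𝒴) → ℝ) (θ : Fin M → ℝ)
    (hfeas : RIRFFeasible μS h θ) :
    ∀ ε : ℝ, 0 < ε → ∃ N₀ : ℕ, ∀ N ≥ N₀,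
      ∃ (𝒵 : Type) (_ : MeasurableSpace 𝒵) (PZ : Measure 𝒵)
        (f : (Fin N → 𝒳) × 𝒵 → ℕ) (g : ℕ × 𝒵 → Fin N → 𝒴),
        IsProbabilityMeasure PZ ∧ Measurable f ∧ Measurable g ∧
        ∀ α : ι,
          (∃ κ : 𝒵 → PMF ℕ,
            IsCondDistrib ((Measure.pi fun _ : Fin N => (μS α).toMeasure).prod PZ)
              (fun ω => f ω) Prod.snd κ ∧
            ∫ z, ent2 (κ z) ∂PZ ≤ (N : ℝ) * (Rbar μS h θ + ε)) ∧
          ∀ j : Fin N, ∃ p : PMF (𝒳 × 𝒴),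
            (((Measure.pi fun _ : Fin N => (μS α).toMeasure).prod PZ).map
                fun ω => (ω.1 j, g (f ω, ω.2) j)) = p.toMeasure ∧
            ∀ i, h i p ≤ θ i := by
  intro ε hε
  obtain ⟨_, ⟨Q, hQ, hs, rfl⟩, hlt⟩ := exists_lt_of_csInf_lt
    (s := {r | ∃ Q ∈ constraintSet μS h θ,
      (∀ α, Summable (miSummand (μS α) Q)) ∧ r = ⨆ α, mutInfo (μS α) Q})
    (by obtain ⟨Q, hQ, hs⟩ := hfeas; exact ⟨_, Q, hQ, hs, rfl⟩)
    (lt_add_of_pos_right (Rbar μS h θ) (half_pos hε))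
  set I := ⨆ α, mutInfo (μS α) Q
  have hI (α : ι) : mutInfo (μS α) Q ≤ I :=
    le_ciSup (f := fun α => mutInfo (μS α) Q) (Set.finite_range _).bddAbove α
  obtain ⟨δ, hδ, hδI⟩ : ∃ δ : ℝ, 0 < δ ∧ (1 + δ) * (1 + δ) * I ≤ I + ε / 4 := by
    have hpos : 0 < 12 * (|I| + 1) := by positivity
    refine ⟨min 1 (ε / (12 * (|I| + 1))), by positivity, ?_⟩
    set δ := min 1 (ε / (12 * (|I| + 1)))
    have h1 : δ ≤ 1 := min_le_left _ _
    have h0 : 0 < δ := by positivity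
    have h2 : δ * (12 * (|I| + 1)) ≤ ε := (le_div_iff₀ hpos).mp (min_le_right _ _)
    have h3 : δ * I ≤ δ * |I| := mul_le_mul_of_nonneg_left (le_abs_self I) h0.le
    have h4 : δ * (δ * I) ≤ 1 * (δ * |I|) :=
      (mul_le_mul_of_nonneg_left h3 h0.le).trans
        (mul_le_mul_of_nonneg_right h1 (by positivity))
    nlinarith
  set m := (Fintype.card ι : ℝ)
  have hm : 1 ≤ m := Nat.one_le_cast.mpr Fintype.card_pos
  set C := (1 + δ) * (1 + δ) * (Real.logb 2 m + 3) + ((1 + δ) * rejectionConst δ +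
    powerCodeConst δ)
  refine ⟨⌈C / (ε / 4)⌉₊, fun N hN => ?_⟩
  have hC : C ≤ N * (ε / 4) := (div_le_iff₀ (by positivity)).mp (Nat.ceil_le.mp hN)
  obtain ⟨𝒵, m𝒵, PZ, f, g, hPZ, hf, hg, hsim⟩ := exists_channel_simulation
    (fun x : Fin N → 𝒳 => productPMF fun j => Q (x j)) (mixtureOutput μS Q N) hδ
  refine ⟨𝒵, m𝒵, PZ, f, g, hPZ, hf, hg, fun α => ?_⟩
  have hac (x : Fin N → 𝒳) (hx : productPMF (fun _ => μS α) x ≠ 0) (y : Fin N → 𝒴)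
      (hy : productPMF (fun j => Q (x j)) y ≠ 0) : mixtureOutput μS Q N y ≠ 0 := by
    intro h0
    have hle := productPMF_le_mixtureOutput μS Q α y
    rw [h0, mul_zero, nonpos_iff_eq_zero, productPMF_apply, Finset.prod_eq_zero_iff] at hle
    obtain ⟨j, -, hj⟩ := hle
    rw [productPMF_apply, Finset.prod_ne_zero_iff] at hx hy
    refine (bind_ne_zero_of_jointPMF_ne_zero (μ := μS α) (Q := Q) (p := (x j, y j)) ?_).2 hj
    rw [jointPMF_apply]
    exact mul_ne_zero (hx j (Finset.mem_univ j)) (hy j (Finset.mem_univ j))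
  refine ⟨⟨fun z => (productPMF fun _ => μS α).map fun x => f (x, z), ?_, ?_⟩, fun j =>
    ⟨jointPMF (μS α) Q, ?_, fun i => hQ α i⟩⟩
  · rw [← toMeasure_productPMF]
    exact isCondDistrib_map _ PZ hf
  · have hr (y : Fin N → 𝒴) : (productPMF (fun _ : Fin N => (μS α).bind Q) y).toReal ≤
        m * (mixtureOutput μS Q N y).toReal := by
      have := ENNReal.toReal_mono (ENNReal.mul_ne_top (ENNReal.natCast_ne_top _)
        (PMF.apply_ne_top _ _)) (productPMF_le_mixtureOutput μS Q α y)
      rwa [ENNReal.toReal_mul, ENNReal.toReal_natCast] at this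
    have hlev := tsum_logRatioLevel_le (hs α) hm hr
    set T : ℝ := N * mutInfo (μS α) Q + (Real.logb 2 m + 3)
    have hlogm : 0 ≤ Real.logb 2 m := Real.logb_nonneg one_lt_two hm
    have hT : 0 ≤ T := by
      have := mutInfo_nonneg (hs α)
      positivity
    have hrej : 0 ≤ rejectionConst δ := rejectionConst_nonneg hδ
    have hpc := powerCodeConst_nonneg hδ
    set b := (1 + δ) * rejectionConst δ + powerCodeConst δ
    have hb : 0 ≤ b := by positivity
    have hone (x : Fin N → 𝒳) (hx : productPMF (fun _ => μS α) x ≠ 0) :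
        ∫⁻ z, ENNReal.ofReal (powerCode δ (f (x, z))) ∂PZ ≤
        ENNReal.ofReal ((1 + δ) * (1 + δ)) * (∑' y, productPMF (fun j => Q (x j)) y *
          (logRatioLevel (productPMF fun j => Q (x j)) (mixtureOutput μS Q N) y : ℝ≥0∞)) +
          ENNReal.ofReal b := by
      have hlog (k : ℕ) : 0 ≤ Real.logb 2 ((k : ℝ) + 1) :=
        Real.logb_nonneg one_lt_two (by simp)
      have hsplit (z : 𝒵) : ENNReal.ofReal (powerCode δ (f (x, z))) =
          ENNReal.ofReal (1 + δ) * ENNReal.ofReal (Real.logb 2 (f (x, z) + 1)) +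
            ENNReal.ofReal (powerCodeConst δ) := by
        rw [powerCode, ENNReal.ofReal_add (mul_nonneg (by positivity) (hlog _)) hpc,
          ENNReal.ofReal_mul (by positivity)]
      simp_rw [hsplit]
      rw [lintegral_add_right _ measurable_const, lintegral_const, measure_univ, mul_one,
        lintegral_const_mul' _ _ ENNReal.ofReal_ne_top]
      grw [(hsim x (hac x hx)).2]
      rw [mul_add, ENNReal.ofReal_add (by positivity) hpc, ENNReal.ofReal_mul (by positivity),
        ENNReal.ofReal_mul (by positivity), mul_assoc, add_assoc]
    have hcost : ∑' x, productPMF (fun _ : Fin N => μS α) x *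
        ∫⁻ z, ENNReal.ofReal (powerCode δ (f (x, z))) ∂PZ ≤
        ENNReal.ofReal ((1 + δ) * (1 + δ) * T + b) := by
      calc _ ≤ ∑' x, (ENNReal.ofReal ((1 + δ) * (1 + δ)) *
            (productPMF (fun _ : Fin N => μS α) x * ∑' y, productPMF (fun j => Q (x j)) y *
              (logRatioLevel (productPMF fun j => Q (x j)) (mixtureOutput μS Q N) y : ℝ≥0∞)) +
            productPMF (fun _ : Fin N => μS α) x * ENNReal.ofReal b) := by
            refine ENNReal.tsum_le_tsum fun x => ?_
            by_cases hx : productPMF (fun _ => μS α) x = 0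
            · simp [hx]
            · rw [mul_left_comm, ← mul_add]
              exact mul_le_mul_right (hone x hx) _
        _ ≤ _ := by
            rw [ENNReal.tsum_add, ENNReal.tsum_mul_left, ENNReal.tsum_mul_right, PMF.tsum_coe,
              one_mul, ENNReal.ofReal_add (by positivity) hb,
              ENNReal.ofReal_mul (p := (1 + δ) * (1 + δ)) (by positivity)]
            gcongr
    refine (integral_ent2_map_le _ PZ hf hδ (by positivity) hcost).trans ?_
    have h1 : (1 + δ) * (1 + δ) * (N * mutInfo (μS α) Q) ≤ N * (I + ε / 4) := by
      calc _ = N * ((1 + δ) * (1 + δ) * mutInfo (μS α) Q) := by ring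
        _ ≤ N * ((1 + δ) * (1 + δ) * I) := by gcongr; exact hI α
        _ ≤ _ := by gcongr
    have h2 : N * (I + ε / 4) + N * (ε / 4) ≤ N * (Rbar μS h θ + ε) := by
      rw [← mul_add]
      exact mul_le_mul_of_nonneg_left (by linarith) N.cast_nonneg
    calc _ = (1 + δ) * (1 + δ) * (N * mutInfo (μS α) Q) + C := by ring
      _ ≤ _ := by linarith
  · refine map_coordinate_eq_jointPMF (μS α) Q PZ (G := fun ω => g (f ω, ω.2)) (by fun_prop) ?_ j
    exact fun x hx => (hsim x (hac x hx)).1
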